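/- arXiv:1509.01603 — 5 statements merged into one kernel-verified Lean document; each statement's English description precedes it below -/
import Mathlib

section
/- Let m ≥ 2, K > 0, δ > 0, T > 0, and let μ_1, ..., μ_m : [0,T] → ℝ be differentiable with |μ_j'(t)| ≤ K for all t and j, and μ_j(t) − μ_i(t) ≥ δ for all i < j and all t. Let D(t) = det V(μ(t)) = ∏_{1≤i<j≤m}(μ_j(t) − μ_i(t)). Then D(t) > 0 and |D'(t)| ≤ m(m−1) (K/δ) D(t) for all t ∈ [0,T]. -/
/-- The Vandermonde determinant `D(t) = ∏_{i<j} (μ_j(t) - μ_i(t))` of a family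
of real functions. -/
noncomputable def vandermondeDet {m : ℕ} (μ : Fin m → ℝ → ℝ) (t : ℝ) : ℝ :=
  ∏ i : Fin m, ∏ j ∈ Finset.Ioi i, (μ j t - μ i t)

/-- If each factor of a finite product is nonnegative at `x` with derivative bounded by `c i` times
its value, then the derivative of the product is bounded by `∑ i, c i` times its value. -/
lemma abs_deriv_finset_prod_le {ι : Type*} {s : Finset ι} {f : ι → ℝ → ℝ} {f' c : ι → ℝ}
    {x : ℝ} (hf : ∀ i ∈ s, HasDerivAt (f i) (f' i) x) (hpos : ∀ i ∈ s, 0 ≤ f i x)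
    (hbd : ∀ i ∈ s, |f' i| ≤ c i * f i x) :
    |deriv (fun y => ∏ i ∈ s, f i y) x| ≤ (∑ i ∈ s, c i) * ∏ i ∈ s, f i x := by
  classical
  rw [(HasDerivAt.fun_finsetProd hf).deriv, Finset.sum_mul]
  refine (Finset.abs_sum_le_sum_abs _ _).trans (Finset.sum_le_sum fun i hi => ?_)
  have herase : 0 ≤ ∏ j ∈ s.erase i, f j x :=
    Finset.prod_nonneg fun j hj => hpos j (Finset.mem_of_mem_erase hj)
  rw [smul_eq_mul, abs_mul, abs_of_nonneg herase, ← Finset.prod_erase_mul s _ hi]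
  calc _ ≤ (∏ j ∈ s.erase i, f j x) * (c i * f i x) :=
        mul_le_mul_of_nonneg_left (hbd i hi) herase
    _ = _ := by ring

/-- The number of pairs `i < j` in `Fin m`, doubled, is `m * (m - 1)`. -/
lemma sum_card_Ioi_fin_mul_two (m : ℕ) :
    (∑ i : Fin m, ((Finset.Ioi i).card : ℝ)) * 2 = m * (m - 1) := by
  induction m with
  | zero => simp
  | succ n ih =>
    have hsucc (i : Fin n) : (Finset.Ioi i.succ).card = (Finset.Ioi i).card := by
      simp only [Fin.card_Ioi, Fin.val_succ]
      omega
    have hzero : (Finset.Ioi (0 : Fin (n + 1))).card = n := by simp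
    rw [Fin.sum_univ_succ, add_mul]
    simp only [hsucc, ih, hzero]
    push_cast
    ring

/-- Logarithmic derivative estimate for the Vandermonde determinant of
differentiable, `δ`-separated nodes with derivatives bounded by `K`:
`D(t) > 0` and `|D'(t)| ≤ m(m-1)(K/δ) D(t)`. -/
theorem vandermonde_log_deriv_bound (m : ℕ) (hm : 2 ≤ m)
    (K δ T : ℝ) (hK : 0 < K) (hδ : 0 < δ) (hT : 0 < T)
    (μ μ' : Fin m → ℝ → ℝ)
    (hderiv : ∀ j : Fin m, ∀ t ∈ Set.Icc (0 : ℝ) T, HasDerivAt (μ j) (μ' j t) t)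
    (hbd : ∀ j : Fin m, ∀ t ∈ Set.Icc (0 : ℝ) T, |μ' j t| ≤ K)
    (hsep : ∀ i j : Fin m, i < j → ∀ t ∈ Set.Icc (0 : ℝ) T, δ ≤ μ j t - μ i t) :
    ∀ t ∈ Set.Icc (0 : ℝ) T,
      0 < vandermondeDet μ t ∧
      HasDerivAt (vandermondeDet μ) (deriv (vandermondeDet μ) t) t ∧
      |deriv (vandermondeDet μ) t| ≤ m * (m - 1) * (K / δ) * vandermondeDet μ t := by
  intro t ht
  have hfactor (i j : Fin m) (hij : j ∈ Finset.Ioi i) : 0 < μ j t - μ i t :=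
    hδ.trans_le (hsep i j (Finset.mem_Ioi.mp hij) t ht)
  have hrow_pos (i : Fin m) : 0 < ∏ j ∈ Finset.Ioi i, (μ j t - μ i t) :=
    Finset.prod_pos (hfactor i)
  have hdiff (i j : Fin m) : HasDerivAt (fun y => μ j y - μ i y) (μ' j t - μ' i t) t :=
    (hderiv j t ht).fun_sub (hderiv i t ht)
  have hfactor_bd (i j : Fin m) (hij : j ∈ Finset.Ioi i) :
      |μ' j t - μ' i t| ≤ 2 * (K / δ) * (μ j t - μ i t) :=
    calc |μ' j t - μ' i t| ≤ |μ' j t| + |μ' i t| := abs_sub _ _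
      _ ≤ 2 * (K / δ) * δ := by
        rw [mul_assoc, div_mul_cancel₀ _ hδ.ne']
        linarith [hbd j t ht, hbd i t ht]
      _ ≤ _ := by
        gcongr
        exact hsep i j (Finset.mem_Ioi.mp hij) t ht
  have hrow (i : Fin m) : HasDerivAt (fun y => ∏ j ∈ Finset.Ioi i, (μ j y - μ i y))
      (deriv (fun y => ∏ j ∈ Finset.Ioi i, (μ j y - μ i y)) t) t :=
    (HasDerivAt.fun_finsetProd fun j _ => hdiff i j).differentiableAt.hasDerivAt
  have hrow_bd (i : Fin m) := abs_deriv_finset_prod_le (fun j _ => hdiff i j)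
    (fun j hj => (hfactor i j hj).le) (hfactor_bd i)
  refine ⟨Finset.prod_pos fun i _ => hrow_pos i,
    (HasDerivAt.fun_finsetProd fun i _ => hrow i).differentiableAt.hasDerivAt, ?_⟩
  refine (abs_deriv_finset_prod_le (fun i _ => hrow i) (fun i _ => (hrow_pos i).le)
    fun i _ => hrow_bd i).trans_eq ?_
  simp only [Finset.sum_const, nsmul_eq_mul]
  rw [← Finset.sum_mul, ← sum_card_Ioi_fin_mul_two, vandermondeDet]
  ring
end

section
/- Let m ≥ 2, M ≥ 1, 0 < δ ≤ 1, and let x_1, ..., x_m ∈ ℝ satisfy |x_j| ≤ M for all j and x_j − x_i ≥ δ for all i < j. Then every entry of the inverse Vandermonde matrix V(x)^{-1} is bounded in absolute value by (2M)^{m−1} δ^{1−m}. -/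
/-- The Vandermonde matrix of `x = (x_1, ..., x_m)`, with entries
`V(x)_{ij} = x_j^(i-1)` (indices `0`-based: entry `(i,j)` is `x_j ^ i`). -/
noncomputable def vanT {m : ℕ} (x : Fin m → ℝ) : Matrix (Fin m) (Fin m) ℝ :=
  (Matrix.vandermonde x).transpose

open Polynomial in
theorem abs_coeff_X_sub_C_mul_le {p : ℝ[X]} {A : ℝ} (hp : ∀ k, |p.coeff k| ≤ A) (y : ℝ) (k : ℕ) :
    |((X - C y) * p).coeff k| ≤ (1 + |y|) * A := by
  have hy : |y * p.coeff k| ≤ |y| * A := by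
    rw [abs_mul]
    exact mul_le_mul_of_nonneg_left (hp k) (abs_nonneg y)
  rw [sub_mul, coeff_sub, coeff_C_mul, add_mul, one_mul]
  refine (abs_sub _ _).trans (add_le_add ?_ hy)
  cases k with
  | zero => simpa using (abs_nonneg _).trans (hp 0)
  | succ k => simpa only [coeff_X_mul] using hp k

/-- The coefficients of a product of Lagrange basis divisors whose nodes are bounded by `M` and at
distance at least `δ` from the base point `a`. -/
theorem abs_coeff_prod_basisDivisor_le {ι : Type*} (s : Finset ι) (x : ι → ℝ) {a M δ : ℝ}
    (hM : 1 ≤ M) (hδ : 0 < δ) (hbd : ∀ j ∈ s, |x j| ≤ M) (hsep : ∀ j ∈ s, δ ≤ |a - x j|) (k : ℕ) :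
    |(∏ j ∈ s, Lagrange.basisDivisor a (x j)).coeff k| ≤ (2 * M / δ) ^ s.card := by
  classical
  induction s using Finset.induction_on generalizing k with
  | empty =>
    rw [Finset.prod_empty, Polynomial.coeff_one]
    split_ifs <;> simp
  | insert j s hj ih =>
    have hs := abs_coeff_X_sub_C_mul_le
      (ih (fun i hi => hbd i (Finset.mem_insert_of_mem hi))
        (fun i hi => hsep i (Finset.mem_insert_of_mem hi))) (x j) k
    have hxj := hbd j (Finset.mem_insert_self j s)
    have hinv : |(a - x j)⁻¹| ≤ δ⁻¹ := by
      rw [abs_inv]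
      exact inv_anti₀ hδ (hsep j (Finset.mem_insert_self j s))
    rw [Finset.prod_insert hj, Finset.card_insert_of_notMem hj, Lagrange.basisDivisor, mul_assoc,
      Polynomial.coeff_C_mul, abs_mul]
    calc _ ≤ δ⁻¹ * ((1 + |x j|) * (2 * M / δ) ^ s.card) := by gcongr
      _ ≤ δ⁻¹ * (2 * M * (2 * M / δ) ^ s.card) := by
        gcongr
        linarith
      _ = (2 * M / δ) ^ (s.card + 1) := by
        rw [pow_succ]
        ring

/-- The inverse Vandermonde matrix has as rows the coefficients of the Lagrange basis. -/
theorem vanT_inv_apply {m : ℕ} {x : Fin m → ℝ} (hx : Function.Injective x) (i j : Fin m) :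
    (vanT x)⁻¹ i j = (Lagrange.basis Finset.univ x i).coeff j := by
  have hmul : (Matrix.of fun i j : Fin m => (Lagrange.basis Finset.univ x i).coeff j) * vanT x
      = 1 := by
    ext i j
    have hdeg : (Lagrange.basis Finset.univ x i).natDegree < m := by
      rw [Lagrange.natDegree_basis hx.injOn (Finset.mem_univ i), Finset.card_univ, Fintype.card_fin]
      have := i.pos
      omega
    have heval : ((Matrix.of fun i j : Fin m => (Lagrange.basis Finset.univ x i).coeff j)
        * vanT x) i j = (Lagrange.basis Finset.univ x i).eval (x j) := by
      rw [Polynomial.eval_eq_sum_range' hdeg, ← Fin.sum_univ_eq_sum_range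
        (fun k => (Lagrange.basis Finset.univ x i).coeff k * x j ^ k)]
      simp [Matrix.mul_apply, vanT, Matrix.vandermonde_apply]
    rw [heval]
    rcases eq_or_ne i j with rfl | hij
    · rw [Lagrange.eval_basis_self hx.injOn (Finset.mem_univ i), Matrix.one_apply_eq]
    · rw [Lagrange.eval_basis_of_ne hij (Finset.mem_univ j), Matrix.one_apply_ne hij]
  rw [Matrix.inv_eq_left_inv hmul, Matrix.of_apply]

/-- Entrywise bound for the inverse Vandermonde matrix of bounded,
`δ`-separated nodes: if `|x_j| ≤ M` (with `M ≥ 1`, `0 < δ ≤ 1`) and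
`x_j - x_i ≥ δ` for `i < j`, then every entry of `V(x)⁻¹` is bounded in
absolute value by `(2M)^(m-1) δ^(1-m)`. -/
theorem vandermonde_inverse_entry_bound (m : ℕ) (hm : 2 ≤ m) (M δ : ℝ)
    (hM : 1 ≤ M) (hδ0 : 0 < δ) (hδ1 : δ ≤ 1)
    (x : Fin m → ℝ) (hbd : ∀ j : Fin m, |x j| ≤ M)
    (hsep : ∀ i j : Fin m, i < j → δ ≤ x j - x i) :
    ∀ i j : Fin m, |(vanT x)⁻¹ i j| ≤ (2 * M) ^ (m - 1) * δ ^ ((1 : ℝ) - m) := by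
  have hdist : ∀ i j : Fin m, i ≠ j → δ ≤ |x i - x j| := by
    intro i j hij
    rcases hij.lt_or_gt with h | h
    · rw [abs_sub_comm]
      exact (hsep i j h).trans (le_abs_self _)
    · exact (hsep j i h).trans (le_abs_self _)
  have hx : Function.Injective x := by
    intro i j hij
    by_contra h
    have := hdist i j h
    rw [hij, sub_self, abs_zero] at this
    exact this.not_gt hδ0
  intro i j
  have hpow : δ ^ ((1 : ℝ) - m) = (δ ^ (m - 1))⁻¹ := by
    rw [← Real.rpow_natCast, ← Real.rpow_neg hδ0.le, Nat.cast_sub (by omega : 1 ≤ m), Nat.cast_one,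
      neg_sub]
  have hcoeff := abs_coeff_prod_basisDivisor_le (Finset.univ.erase i) x hM hδ0
    (fun j _ => hbd j) (fun j hj => hdist i j (Finset.ne_of_mem_erase hj).symm) j
  rwa [Finset.card_erase_of_mem (Finset.mem_univ i), Finset.card_univ, Fintype.card_fin, div_pow,
    div_eq_mul_inv, ← hpow, ← Lagrange.basis, ← vanT_inv_apply hx] at hcoeff
end

section
/- Let m ≥ 2, K > 0, δ > 0, c ≥ 1, T > 0, and let μ_1, ..., μ_m : [0,T] → ℝ be differentiable with: |μ_j'(t)| ≤ K for all j and t; μ_j(t) − μ_i(t) ≥ (j−i)δ for all i < j and all t; and the uniform property |μ_i(t) − μ_j(t)| ≤ c|μ_k(t) − μ_{k−1}(t)| for all 1 ≤ i,j ≤ m, 2 ≤ k ≤ m, and all t. Let H(t) = V(μ(t)) be the Vandermonde matrix of (μ_1(t), ..., μ_m(t)). Then there exists a constant C depending only on m and c such that ‖H(t)^{-1} ∂_t H(t)‖ ≤ C K/δ for all t ∈ [0,T]. -/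
/-- The operator norm of a real `m × m` matrix acting on the Hermitian space
`ℂ^m`. -/
noncomputable def cOpNorm {m : ℕ} (A : Matrix (Fin m) (Fin m) ℝ) : ℝ :=
  ‖Matrix.toEuclideanCLM (𝕜 := ℂ) (A.map Complex.ofReal)‖

open Polynomial in
theorem vanT_inv_mul_apply {m : ℕ} {x : Fin m → ℝ} (hx : Function.Injective x)
    (y : Fin m → ℝ) (k j : Fin m) :
    ((vanT x)⁻¹ * Matrix.of fun i j : Fin m => ((i : ℕ) : ℝ) * x j ^ ((i : ℕ) - 1) * y j) k j =
      (derivative (Lagrange.basis Finset.univ x k)).eval (x j) * y j := by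
  have hdeg : ∀ k, (Lagrange.basis Finset.univ x k).natDegree < m := by
    intro k
    have hd := Lagrange.degree_basis (s := Finset.univ) (v := x) hx.injOn (Finset.mem_univ k)
    have := natDegree_eq_of_degree_eq_some hd
    have hm : 0 < m := k.pos
    rw [this, Finset.card_univ, Fintype.card_fin]
    omega
  have hinv : (vanT x)⁻¹ =
      Matrix.of fun k i : Fin m => (Lagrange.basis Finset.univ x k).coeff i := by
    apply Matrix.inv_eq_left_inv
    ext k j
    simp only [Matrix.mul_apply, Matrix.of_apply, vanT, Matrix.transpose_apply,
      Matrix.vandermonde_apply]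
    rw [Fin.sum_univ_eq_sum_range (fun i => (Lagrange.basis Finset.univ x k).coeff i * x j ^ i),
      ← eval_eq_sum_range' (hdeg k)]
    by_cases h : k = j
    · subst h
      rw [Lagrange.eval_basis_self hx.injOn (Finset.mem_univ _), Matrix.one_apply_eq]
    · rw [Lagrange.eval_basis_of_ne h (Finset.mem_univ _), Matrix.one_apply_ne h]
  rw [hinv, derivative_eval, sum_over_range' _ (by simp) m (hdeg k), Finset.sum_mul,
    Matrix.mul_apply,
    ← Fin.sum_univ_eq_sum_range (fun n => (Lagrange.basis Finset.univ x k).coeff n * (n : ℝ) *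
      x j ^ (n - 1) * y j)]
  refine Finset.sum_congr rfl fun i _ => ?_
  simp only [Matrix.of_apply]
  ring

open Polynomial in
theorem abs_eval_derivative_lagrangeBasis_le {m : ℕ} {x : Fin m → ℝ} {c δ : ℝ} (hc : 1 ≤ c)
    (hδ : 0 < δ) (hsep : ∀ a b, a ≠ b → δ ≤ |x a - x b|)
    (hunif : ∀ i j a b, a ≠ b → |x i - x j| ≤ c * |x a - x b|) (k j : Fin m) :
    |(derivative (Lagrange.basis Finset.univ x k)).eval (x j)| ≤ m * (c ^ m * δ⁻¹) := by
  rw [Lagrange.basis, derivative_prod_finset, eval_finsetSum]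
  refine (Finset.abs_sum_le_sum_abs _ _).trans ?_
  have hterm : ∀ a ∈ Finset.univ.erase k,
      |eval (x j) ((∏ b ∈ (Finset.univ.erase k).erase a, Lagrange.basisDivisor (x k) (x b)) *
        derivative (Lagrange.basisDivisor (x k) (x a)))| ≤ c ^ m * δ⁻¹ := by
    intro a ha
    have hak : k ≠ a := (Finset.ne_of_mem_erase ha).symm
    rw [eval_mul, abs_mul, eval_prod, Finset.abs_prod]
    gcongr
    · calc ∏ b ∈ (Finset.univ.erase k).erase a,
            |eval (x j) (Lagrange.basisDivisor (x k) (x b))|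
          ≤ ∏ b ∈ (Finset.univ.erase k).erase a, c := by
            refine Finset.prod_le_prod (fun _ _ => abs_nonneg _) fun b hb => ?_
            have hbk : k ≠ b := (Finset.ne_of_mem_erase (Finset.mem_of_mem_erase hb)).symm
            have hpos : 0 < |x k - x b| := hδ.trans_le (hsep _ _ hbk)
            have h := hunif j b k b hbk
            simp only [Lagrange.basisDivisor, eval_mul, eval_C, eval_sub, eval_X, abs_mul, abs_inv]
            rwa [inv_mul_le_iff₀ hpos, mul_comm]
        _ ≤ c ^ m := by
            rw [Finset.prod_const]
            refine pow_le_pow_right₀ hc ?_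
            exact (Finset.card_le_univ _).trans (Fintype.card_fin m).le
    · have h := hsep k a hak
      simp only [Lagrange.basisDivisor, derivative_mul, derivative_C, derivative_sub,
        derivative_X, zero_mul, zero_add, sub_zero, mul_one, eval_C, abs_inv]
      gcongr
  refine (Finset.sum_le_sum hterm).trans ?_
  rw [Finset.sum_const, nsmul_eq_mul]
  have hcard : ((Finset.univ.erase k).card : ℝ) ≤ m := by
    exact_mod_cast (Finset.card_le_univ _).trans (Fintype.card_fin m).le
  gcongr

theorem cOpNorm_le_of_abs_le {m : ℕ} {A : Matrix (Fin m) (Fin m) ℝ} {B : ℝ} (hB : 0 ≤ B)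
    (hA : ∀ i j, |A i j| ≤ B) : cOpNorm A ≤ m * (m * B) := by
  refine ContinuousLinearMap.opNorm_le_bound _ (by positivity) fun v => ?_
  have hcoord : ∀ i,
      ‖Matrix.toEuclideanCLM (𝕜 := ℂ) (A.map Complex.ofReal) v i‖ ≤ m * B * ‖v‖ := by
    intro i
    rw [Matrix.ofLp_toEuclideanCLM, Matrix.mulVec, dotProduct]
    calc _ ≤ ∑ j, ‖(A.map Complex.ofReal) i j * v j‖ := norm_sum_le _ _
      _ ≤ ∑ _j : Fin m, B * ‖v‖ := by
          refine Finset.sum_le_sum fun j _ => ?_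
          rw [norm_mul, Matrix.map_apply, Complex.norm_real, Real.norm_eq_abs]
          exact mul_le_mul (hA i j) (PiLp.norm_apply_le v j) (norm_nonneg _) hB
      _ = _ := by simp [mul_assoc]
  rw [EuclideanSpace.norm_eq]
  refine Real.sqrt_le_iff.mpr ⟨by positivity, ?_⟩
  calc _ ≤ ∑ _i : Fin m, (m * B * ‖v‖) ^ 2 :=
        Finset.sum_le_sum fun i _ => pow_le_pow_left₀ (norm_nonneg _) (hcoord i) 2
    _ = (m : ℝ) * (m * B * ‖v‖) ^ 2 := by simp
    _ ≤ (m : ℝ) ^ 2 * (m * B * ‖v‖) ^ 2 := by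
        gcongr
        exact_mod_cast Nat.le_self_pow two_ne_zero m
    _ = _ := by ring

theorem abs_sub_le_mul_abs_sub_of_adjacent {m : ℕ} {x : Fin m → ℝ} {c : ℝ} (hc : 0 ≤ c)
    (hmono : Monotone x)
    (hunif : ∀ i j : Fin m, ∀ k : ℕ, ∀ hk : k + 1 < m,
      |x i - x j| ≤ c * |x ⟨k + 1, hk⟩ - x ⟨k, Nat.lt_of_succ_lt hk⟩|)
    (i j a b : Fin m) (hab : a ≠ b) : |x i - x j| ≤ c * |x a - x b| := by
  wlog h : b < a generalizing a b
  · rw [abs_sub_comm (x a)]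
    exact this b a hab.symm (lt_of_le_of_ne (not_lt.mp h) hab)
  have hk : (b : ℕ) + 1 < m := lt_of_le_of_lt h a.isLt
  refine (hunif i j b hk).trans ?_
  have h1 : x b ≤ x ⟨b + 1, hk⟩ := hmono (Nat.le_succ b)
  have h2 : x ⟨b + 1, hk⟩ ≤ x a := hmono (show (b : ℕ) + 1 ≤ a from h)
  gcongr

/-- The estimate `‖H(t)⁻¹ ∂_t H(t)‖ ≤ C K/δ` for the Vandermonde matrix
`H(t) = V(μ(t))` of differentiable nodes with `|μ_j'| ≤ K`, separation
`μ_j - μ_i ≥ (j-i)δ`, and the uniform property with constant `c`; the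
constant `C` depends only on `m` and `c`. -/
theorem vandermonde_inv_mul_deriv_bound (m : ℕ) (hm : 2 ≤ m) (c : ℝ) (hc : 1 ≤ c) :
    ∃ C : ℝ, 0 < C ∧
      ∀ K δ T : ℝ, 0 < K → 0 < δ → 0 < T →
        ∀ μ μ' : Fin m → ℝ → ℝ,
          (∀ j : Fin m, ∀ t ∈ Set.Icc (0 : ℝ) T, HasDerivAt (μ j) (μ' j t) t) →
          (∀ j : Fin m, ∀ t ∈ Set.Icc (0 : ℝ) T, |μ' j t| ≤ K) →
          (∀ i j : Fin m, i < j → ∀ t ∈ Set.Icc (0 : ℝ) T,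
            ((j : ℕ) - (i : ℕ) : ℝ) * δ ≤ μ j t - μ i t) →
          (∀ i j : Fin m, ∀ k : ℕ, ∀ hk : k + 1 < m, ∀ t ∈ Set.Icc (0 : ℝ) T,
            |μ i t - μ j t| ≤
              c * |μ ⟨k + 1, hk⟩ t - μ ⟨k, Nat.lt_of_succ_lt hk⟩ t|) →
          ∀ t ∈ Set.Icc (0 : ℝ) T,
            cOpNorm
                ((vanT (fun k => μ k t))⁻¹ *
                  Matrix.of fun i j : Fin m =>
                    deriv (fun s => vanT (fun k => μ k s) i j) t) ≤
              C * K / δ := by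
  refine ⟨m * (m * (m * c ^ m)), by positivity, ?_⟩
  intro K δ T hK hδ _ μ μ' hderiv hbound hsep hunif t ht
  have hlt : ∀ i j : Fin m, i < j → δ ≤ μ j t - μ i t := by
    intro i j hij
    refine le_trans ?_ (hsep i j hij t ht)
    have : ((i : ℕ) : ℝ) + 1 ≤ (j : ℕ) := by exact_mod_cast hij
    nlinarith
  have hmono : StrictMono fun k => μ k t := fun i j hij => by
    have := hlt i j hij
    simp only
    linarith
  have habs : ∀ a b : Fin m, a ≠ b → δ ≤ |μ a t - μ b t| := by
    intro a b hab
    rcases lt_or_gt_of_ne hab with h | h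
    · rw [abs_sub_comm]
      exact (hlt a b h).trans (le_abs_self _)
    · exact (hlt b a h).trans (le_abs_self _)
  have hH : (Matrix.of fun i j : Fin m => deriv (fun s => vanT (fun k => μ k s) i j) t) =
      Matrix.of fun i j : Fin m => ((i : ℕ) : ℝ) * μ j t ^ ((i : ℕ) - 1) * μ' j t := by
    ext i j
    exact ((hderiv j t ht).fun_pow (i : ℕ)).deriv
  have hentry : ∀ k j : Fin m, |((vanT (fun k => μ k t))⁻¹ *
      Matrix.of fun i j : Fin m => ((i : ℕ) : ℝ) * μ j t ^ ((i : ℕ) - 1) * μ' j t) k j| ≤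
      m * (c ^ m * δ⁻¹) * K := by
    intro k j
    rw [vanT_inv_mul_apply hmono.injective (fun j => μ' j t) k j, abs_mul]
    gcongr
    · exact abs_eval_derivative_lagrangeBasis_le hc hδ habs
        (abs_sub_le_mul_abs_sub_of_adjacent (zero_le_one.trans hc) hmono.monotone
          fun i j k hk => hunif i j k hk t ht) k j
    · exact hbound j t ht
  rw [hH]
  refine (cOpNorm_le_of_abs_le (by positivity) hentry).trans (le_of_eq ?_)
  ring
end

section
/- Let m ≥ 2, M ≥ 1, 0 < δ ≤ 1. Let x_1, ..., x_m and y_1, ..., y_m be real numbers with |x_j| ≤ M and |y_j| ≤ M for all j, x_j − x_i ≥ δ and y_j − y_i ≥ δ for all i < j. Then there exists a constant C depending only on m and M (and not on δ) such that (det V(x) / det V(y)) · ‖V(y)‖ · ‖V(x)^{-1}‖ ≤ C δ^{−m(m−1)/2}. -/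
/-- The operator norm of a real `m × m` matrix acting on Euclidean space `ℝ^m`. -/
noncomputable def rOpNorm {m : ℕ} (A : Matrix (Fin m) (Fin m) ℝ) : ℝ :=
  ‖Matrix.toEuclideanCLM (𝕜 := ℝ) A‖

theorem continuous_vanT {m : ℕ} : Continuous (vanT : (Fin m → ℝ) → Matrix (Fin m) (Fin m) ℝ) :=
  continuous_matrix fun i j => by
    simp only [vanT, Matrix.transpose_apply, Matrix.vandermonde_apply]
    fun_prop

theorem continuous_rOpNorm {m : ℕ} :
    Continuous (rOpNorm : Matrix (Fin m) (Fin m) ℝ → ℝ) :=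
  continuous_norm.comp (LinearMap.continuous_of_finiteDimensional
    (Matrix.toEuclideanCLM (n := Fin m) (𝕜 := ℝ)).toAlgEquiv.toLinearMap)

theorem rOpNorm_nonneg {m : ℕ} (A : Matrix (Fin m) (Fin m) ℝ) : 0 ≤ rOpNorm A :=
  norm_nonneg _

theorem rOpNorm_smul {m : ℕ} (c : ℝ) (A : Matrix (Fin m) (Fin m) ℝ) :
    rOpNorm (c • A) = |c| * rOpNorm A := by
  rw [rOpNorm, map_smul, norm_smul, Real.norm_eq_abs, rOpNorm]

/-- A continuous function is bounded above on the box `[-M, M]^m` by a positive constant. -/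
theorem exists_pos_bound_on_box {m : ℕ} (M : ℝ) {f : (Fin m → ℝ) → ℝ} (hf : Continuous f) :
    ∃ K : ℝ, 0 < K ∧ ∀ x : Fin m → ℝ, (∀ j, |x j| ≤ M) → f x ≤ K := by
  obtain ⟨K, hK⟩ := (isCompact_Icc (a := fun _ : Fin m => -M)
    (b := fun _ => M)).bddAbove_image hf.continuousOn
  refine ⟨max K 1, by positivity, fun x hx => le_max_of_le_left (hK ⟨x, ⟨?_, ?_⟩, rfl⟩)⟩
  · exact fun j => (abs_le.1 (hx j)).1
  · exact fun j => (abs_le.1 (hx j)).2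

theorem Fin.sum_card_Ioi (m : ℕ) :
    ((∑ i : Fin m, (Finset.Ioi i).card : ℕ) : ℝ) = (m : ℝ) * (m - 1) / 2 := by
  simp only [Fin.card_Ioi]
  rw [Fin.sum_univ_eq_sum_range (fun i => m - 1 - i) m, Finset.sum_range_reflect (fun i => i) m,
    Finset.sum_range_id, ← Nat.choose_two_right, Nat.cast_choose_two]

/-- The Vandermonde determinant of `δ`-separated increasing nodes is at least
`δ ^ (m (m - 1) / 2)`. -/
theorem rpow_le_det_vanT {m : ℕ} {δ : ℝ} (hδ : 0 < δ) {x : Fin m → ℝ}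
    (hx : ∀ i j : Fin m, i < j → δ ≤ x j - x i) :
    δ ^ ((m : ℝ) * (m - 1) / 2) ≤ (vanT x).det := by
  rw [vanT, Matrix.det_transpose, Matrix.det_vandermonde, ← Fin.sum_card_Ioi, Real.rpow_natCast,
    ← Finset.prod_pow_eq_pow_sum]
  refine Finset.prod_le_prod (fun i _ => by positivity) fun i _ => ?_
  rw [← Finset.prod_const]
  exact Finset.prod_le_prod (fun _ _ => hδ.le) fun j hj => hx i j (Finset.mem_Ioi.1 hj)

/-- Multiplying the inverse by the determinant gives the adjugate, also at the level of norms. -/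
theorem det_mul_rOpNorm_inv {m : ℕ} {A : Matrix (Fin m) (Fin m) ℝ} (hA : 0 < A.det) :
    A.det * rOpNorm A⁻¹ = rOpNorm A.adjugate := by
  rw [Matrix.inv_def, Ring.inverse_eq_inv', rOpNorm_smul, abs_of_pos (inv_pos.2 hA),
    mul_inv_cancel_left₀ hA.ne']

/-- Bound on the loss from switching between the solution and the energy
variable: there is `C = C(m, M)`, independent of `δ`, such that for bounded
`δ`-separated nodes `x` and `y`,
`(det V(x) / det V(y)) ‖V(y)‖ ‖V(x)⁻¹‖ ≤ C δ^{-m(m-1)/2}`. -/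
theorem vandermonde_switching_loss (m : ℕ) (hm : 2 ≤ m) (M : ℝ) (hM : 1 ≤ M) :
    ∃ C : ℝ, 0 < C ∧
      ∀ δ : ℝ, 0 < δ → δ ≤ 1 →
        ∀ x y : Fin m → ℝ,
          (∀ j : Fin m, |x j| ≤ M) → (∀ j : Fin m, |y j| ≤ M) →
          (∀ i j : Fin m, i < j → δ ≤ x j - x i) →
          (∀ i j : Fin m, i < j → δ ≤ y j - y i) →
          (vanT x).det / (vanT y).det * rOpNorm (vanT y) * rOpNorm (vanT x)⁻¹ ≤
            C * δ ^ (-((m : ℝ) * (m - 1)) / 2) := by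
  obtain ⟨K, hK, hKb⟩ := exists_pos_bound_on_box (m := m) M (continuous_rOpNorm.comp continuous_vanT)
  obtain ⟨L, hL, hLb⟩ := exists_pos_bound_on_box (m := m) M
    (continuous_rOpNorm.comp continuous_vanT.matrix_adjugate)
  refine ⟨K * L, mul_pos hK hL, fun δ hδ _ x y hxM hyM hx hy => ?_⟩
  have hpow : 0 < δ ^ ((m : ℝ) * (m - 1) / 2) := Real.rpow_pos_of_pos hδ _
  have hdx := hpow.trans_le (rpow_le_det_vanT hδ hx)
  have hdy := rpow_le_det_vanT hδ hy
  calc (vanT x).det / (vanT y).det * rOpNorm (vanT y) * rOpNorm (vanT x)⁻¹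
      = rOpNorm (vanT y) * ((vanT x).det * rOpNorm (vanT x)⁻¹) * ((vanT y).det)⁻¹ := by ring
    _ = rOpNorm (vanT y) * rOpNorm (vanT x).adjugate * ((vanT y).det)⁻¹ := by
      rw [det_mul_rOpNorm_inv hdx]
    _ ≤ K * L * (δ ^ ((m : ℝ) * (m - 1) / 2))⁻¹ :=
      mul_le_mul (mul_le_mul (hKb y hyM) (hLb x hxM) (rOpNorm_nonneg _) hK.le)
        (inv_anti₀ hpow hdy) (inv_nonneg.2 (hpow.le.trans hdy)) (by positivity)
    _ = K * L * δ ^ (-((m : ℝ) * (m - 1)) / 2) := by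
      rw [← Real.rpow_neg hδ.le, neg_div]
end

section
/- Let m ≥ 2, 0 < α ≤ 1, K > 0, c ≥ 1, and let λ_1, ..., λ_m : ℝ × ℝ^n → ℝ be continuous with λ_1(t,ξ) ≤ ... ≤ λ_m(t,ξ), with |λ_j(t,ξ) − λ_j(s,ξ)| ≤ K|t−s|^α⟨ξ⟩ for all t,s,ξ,j, and satisfying the uniform property |λ_i(t,ξ) − λ_j(t,ξ)| ≤ c|λ_k(t,ξ) − λ_{k−1}(t,ξ)| for all 1 ≤ i,j ≤ m, 2 ≤ k ≤ m, and all (t,ξ). Let φ be a mollifier and, for ε ∈ (0,1], set λ_{j,ε}(t,ξ) = (λ_j(·,ξ) * φ_ε)(t) + j ε^α ⟨ξ⟩. Then the regularisations satisfy the uniform property with constant c + m: |λ_{i,ε}(t,ξ) − λ_{j,ε}(t,ξ)| ≤ (c + m)|λ_{k,ε}(t,ξ) − λ_{k−1,ε}(t,ξ)| for all 1 ≤ i,j ≤ m, 2 ≤ k ≤ m, all ε ∈ (0,1], and all (t,ξ). -/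
open MeasureTheory

/-- The Japanese bracket `⟨ξ⟩ = (1 + |ξ|²)^(1/2)`. -/
noncomputable def jap {n : ℕ} (ξ : EuclideanSpace ℝ (Fin n)) : ℝ :=
  Real.sqrt (1 + ‖ξ‖ ^ 2)

/-- The rescaled kernel `φ_ε(t) = ε⁻¹ φ(t/ε)`. -/
noncomputable def mollRescale (φ : ℝ → ℝ) (ε : ℝ) (t : ℝ) : ℝ := ε⁻¹ * φ (t / ε)

/-- The regularised, separated eigenvalues
`λ_{j,ε}(t,ξ) = (λ_j(·,ξ) * φ_ε)(t) + (j+1) ε^α ⟨ξ⟩`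
(the index `j : Fin m` is `0`-based, so `j + 1` ranges over `1, ..., m`). -/
noncomputable def lamReg {n m : ℕ} (lam : Fin m → ℝ → EuclideanSpace ℝ (Fin n) → ℝ)
    (φ : ℝ → ℝ) (α : ℝ) (j : Fin m) (ε t : ℝ) (ξ : EuclideanSpace ℝ (Fin n)) : ℝ :=
  (∫ s : ℝ, lam j (t - s) ξ * mollRescale φ ε s) + ((j : ℕ) + 1) * ε ^ α * jap ξ

/-- Pairing with a fixed nonnegative compactly supported kernel preserves bounds of the form
`|f₁ - f₂| ≤ c * (f₃ - f₄)`. -/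
theorem abs_integral_mul_sub_le {g f₁ f₂ f₃ f₄ : ℝ → ℝ} {c : ℝ}
    (hg : Continuous g) (hgc : HasCompactSupport g) (hg0 : ∀ s, 0 ≤ g s)
    (h₁ : Continuous f₁) (h₂ : Continuous f₂) (h₃ : Continuous f₃) (h₄ : Continuous f₄)
    (h : ∀ s, |f₁ s - f₂ s| ≤ c * (f₃ s - f₄ s)) :
    |(∫ s, f₁ s * g s) - ∫ s, f₂ s * g s| ≤
      c * ((∫ s, f₃ s * g s) - ∫ s, f₄ s * g s) := by
  have hint : ∀ {f : ℝ → ℝ}, Continuous f → Integrable fun s => f s * g s := fun hf =>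
    (hf.mul hg).integrable_of_hasCompactSupport hgc.mul_left
  rw [← integral_sub (hint h₁) (hint h₂), ← integral_sub (hint h₃) (hint h₄),
    ← integral_const_mul, ← Real.norm_eq_abs]
  refine norm_integral_le_of_norm_le (((hint h₃).sub (hint h₄)).const_mul c)
    (Filter.Eventually.of_forall fun s => ?_)
  rw [← sub_mul, ← sub_mul, Real.norm_eq_abs, abs_mul, abs_of_nonneg (hg0 s), ← mul_assoc]
  exact mul_le_mul_of_nonneg_right (h s) (hg0 s)

theorem continuous_mollRescale {φ : ℝ → ℝ} (hφ : Continuous φ) (ε : ℝ) :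
    Continuous (mollRescale φ ε) :=
  continuous_const.mul (hφ.comp (continuous_id.div_const ε))

theorem hasCompactSupport_mollRescale {φ : ℝ → ℝ} (hφ : HasCompactSupport φ) {ε : ℝ}
    (hε : ε ≠ 0) : HasCompactSupport (mollRescale φ ε) := by
  have h : HasCompactSupport fun t : ℝ => φ (t / ε) := by
    simpa [div_eq_mul_inv, Function.comp_def] using
      hφ.comp_homeomorph (Homeomorph.mulRight₀ ε⁻¹ (inv_ne_zero hε))
  exact h.mul_left

theorem mollRescale_nonneg {φ : ℝ → ℝ} (hφ : ∀ t, 0 ≤ φ t) {ε : ℝ} (hε : 0 ≤ ε) (t : ℝ) :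
    0 ≤ mollRescale φ ε t :=
  mul_nonneg (inv_nonneg.mpr hε) (hφ _)

/-- The uniform property transfers from the ordered `α`-Hölder eigenvalues
(with constant `c`) to their separated regularisations `λ_{j,ε}` with constant
`c + m`. -/
theorem uniform_property_of_regularisation (n m : ℕ) (hm : 2 ≤ m)
    (α K c : ℝ) (hα0 : 0 < α) (hα1 : α ≤ 1) (hK : 0 < K) (hc : 1 ≤ c)
    (lam : Fin m → ℝ → EuclideanSpace ℝ (Fin n) → ℝ)
    (hcont : ∀ j : Fin m,
      Continuous fun p : ℝ × EuclideanSpace ℝ (Fin n) => lam j p.1 p.2)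
    (horder : ∀ i j : Fin m, i ≤ j → ∀ (t : ℝ) (ξ : EuclideanSpace ℝ (Fin n)),
      lam i t ξ ≤ lam j t ξ)
    (hHolder : ∀ j : Fin m, ∀ t s : ℝ, ∀ ξ : EuclideanSpace ℝ (Fin n),
      |lam j t ξ - lam j s ξ| ≤ K * |t - s| ^ α * jap ξ)
    (huniform : ∀ i j : Fin m, ∀ k : ℕ, ∀ hk : k + 1 < m,
      ∀ (t : ℝ) (ξ : EuclideanSpace ℝ (Fin n)),
        |lam i t ξ - lam j t ξ| ≤
          c * |lam ⟨k + 1, hk⟩ t ξ - lam ⟨k, Nat.lt_of_succ_lt hk⟩ t ξ|)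
    (φ : ℝ → ℝ) (hφ : ContDiff ℝ (⊤ : ℕ∞) φ) (hφc : HasCompactSupport φ)
    (hφ0 : ∀ t, 0 ≤ φ t) (hφ1 : ∫ t : ℝ, φ t = 1) :
    ∀ i j : Fin m, ∀ k : ℕ, ∀ hk : k + 1 < m,
      ∀ ε : ℝ, 0 < ε → ε ≤ 1 →
        ∀ (t : ℝ) (ξ : EuclideanSpace ℝ (Fin n)),
          |lamReg lam φ α i ε t ξ - lamReg lam φ α j ε t ξ| ≤
            (c + m) *
              |lamReg lam φ α ⟨k + 1, hk⟩ ε t ξ -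
                lamReg lam φ α ⟨k, Nat.lt_of_succ_lt hk⟩ ε t ξ| := by
  intro i j k hk ε hε _ t ξ
  have hcont' : ∀ l : Fin m, Continuous fun s => lam l (t - s) ξ := fun l =>
    (hcont l).comp ((continuous_const.sub continuous_id).prodMk continuous_const)
  have hgap : ∀ s : ℝ,
      0 ≤ lam ⟨k + 1, hk⟩ s ξ - lam ⟨k, Nat.lt_of_succ_lt hk⟩ s ξ := fun s =>
    sub_nonneg.mpr (horder _ _ (Fin.mk_le_mk.mpr k.le_succ) s ξ)
  have key : ∀ i j : Fin m, _ := fun i j =>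
    abs_integral_mul_sub_le (c := c) (continuous_mollRescale hφ.continuous ε)
      (hasCompactSupport_mollRescale hφc hε.ne') (mollRescale_nonneg hφ0 hε.le)
      (hcont' i) (hcont' j) (hcont' ⟨k + 1, hk⟩) (hcont' ⟨k, Nat.lt_of_succ_lt hk⟩)
      (fun s => by simpa only [abs_of_nonneg (hgap (t - s))] using huniform i j k hk (t - s) ξ)
  have hij := key i j
  have hD := (abs_nonneg _).trans hij
  have he : 0 ≤ ε ^ α * jap ξ := mul_nonneg (Real.rpow_nonneg hε.le _) (Real.sqrt_nonneg _)
  have hindex : |((i : ℕ) : ℝ) - (j : ℕ)| ≤ m := by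
    have hi : ((i : ℕ) : ℝ) ≤ m := by exact_mod_cast i.2.le
    have hj : ((j : ℕ) : ℝ) ≤ m := by exact_mod_cast j.2.le
    exact abs_sub_le_of_nonneg_of_le (Nat.cast_nonneg _) hi (Nat.cast_nonneg _) hj
  simp only [lamReg, Nat.cast_add, Nat.cast_one]
  set A := ∫ s, lam i (t - s) ξ * mollRescale φ ε s
  set B := ∫ s, lam j (t - s) ξ * mollRescale φ ε s
  set P := ∫ s, lam ⟨k + 1, hk⟩ (t - s) ξ * mollRescale φ ε s
  set Q := ∫ s, lam ⟨k, Nat.lt_of_succ_lt hk⟩ (t - s) ξ * mollRescale φ ε s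
  set e := ε ^ α * jap ξ with he_def
  have hc0 : 0 < c := one_pos.trans_le hc
  have hPQ : 0 ≤ P - Q := nonneg_of_mul_nonneg_right hD hc0
  calc
    _ = |(A - B) + (((i : ℕ) : ℝ) - (j : ℕ)) * e| := by congr 1; rw [he_def]; ring
    _ ≤ |A - B| + |((i : ℕ) : ℝ) - (j : ℕ)| * e := by
      simpa only [abs_mul, abs_of_nonneg he] using
        abs_add_le (A - B) ((((i : ℕ) : ℝ) - (j : ℕ)) * e)
    _ ≤ c * (P - Q) + m * e := add_le_add hij (mul_le_mul_of_nonneg_right hindex he)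
    _ ≤ (c + m) * ((P - Q) + e) := by
      have := mul_nonneg (Nat.cast_nonneg (α := ℝ) m) hPQ
      have := mul_nonneg hc0.le he
      linarith
    _ = (c + m) * |(P - Q) + e| := by rw [abs_of_nonneg (add_nonneg hPQ he)]
    _ = _ := by congr 2; rw [he_def]; ring
end
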